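/- arXiv:2311.05762 — 2 statements merged into one kernel-verified Lean document; each statement's English description precedes it below -/
import Mathlib

section
/- Let π : H → H' be a homomorphism between abelian groups and let Z_1, Z_2 be finitely supported H-valued random variables. Then d[Z_1; Z_2] ≥ d[π(Z_1); π(Z_2)] + d[Z_1 | π(Z_1); Z_2 | π(Z_2)]. Moreover, if Z_1, Z_2 are independent, then the difference between the left-hand side and the right-hand side equals the conditional mutual information I[Z_1 − Z_2 : (π(Z_1), π(Z_2)) | π(Z_1 − Z_2)]. -/
open scoped Classical BigOperators Pointwise
open Finset

noncomputable section

/-- The probability that the random variable `X` equals `s`, under the pmf `μ`. -/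
def pmass {Ω S : Type*} [Fintype Ω] (μ : Ω → ℝ) (X : Ω → S) (s : S) : ℝ :=
  ∑ ω, if X ω = s then μ ω else 0

/-- `μ` is a probability mass function on the finite type `Ω`. -/
def IsProb {Ω : Type*} [Fintype Ω] (μ : Ω → ℝ) : Prop :=
  (∀ ω, 0 ≤ μ ω) ∧ ∑ ω, μ ω = 1

/-- Shannon entropy `H[X]` of a random variable `X : Ω → S` under `μ`. -/
def ent {Ω S : Type*} [Fintype Ω] (μ : Ω → ℝ) (X : Ω → S) : ℝ :=
  ∑ s ∈ Finset.univ.image X, Real.negMulLog (pmass μ X s)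

/-- Mutual information `I[X : Y]`. -/
def mutualInfo {Ω S T : Type*} [Fintype Ω] (μ : Ω → ℝ) (X : Ω → S) (Y : Ω → T) : ℝ :=
  ent μ X + ent μ Y - ent μ (fun ω => (X ω, Y ω))

/-- The conditional measure, conditioning on the event `Y = y`. -/
def condMeas {Ω T : Type*} [Fintype Ω] (μ : Ω → ℝ) (Y : Ω → T) (y : T) : Ω → ℝ :=
  fun ω => if Y ω = y then μ ω / pmass μ Y y else 0

/-- Conditional mutual information `I[X : Y | Z]`. -/
def condMutualInfo {Ω S T U : Type*} [Fintype Ω] (μ : Ω → ℝ)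
    (X : Ω → S) (Y : Ω → T) (Z : Ω → U) : ℝ :=
  ∑ z ∈ Finset.univ.image Z, pmass μ Z z * mutualInfo (condMeas μ Z z) X Y

/-- Entropic Ruzsa distance `d[X ; Y]`, defined via independent copies on a product space. -/
def rdist {Ω₁ Ω₂ G : Type*} [Fintype Ω₁] [Fintype Ω₂] [AddCommGroup G]
    (μ₁ : Ω₁ → ℝ) (X : Ω₁ → G) (μ₂ : Ω₂ → ℝ) (Y : Ω₂ → G) : ℝ :=
  ent (fun p : Ω₁ × Ω₂ => μ₁ p.1 * μ₂ p.2) (fun p => X p.1 - Y p.2)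
    - ent μ₁ X / 2 - ent μ₂ Y / 2

/-- Conditional Ruzsa distance `d[X | Z ; Y | W]`. -/
def condRdist {Ω₁ Ω₂ G T U : Type*} [Fintype Ω₁] [Fintype Ω₂] [AddCommGroup G]
    (μ₁ : Ω₁ → ℝ) (X : Ω₁ → G) (Z : Ω₁ → T)
    (μ₂ : Ω₂ → ℝ) (Y : Ω₂ → G) (W : Ω₂ → U) : ℝ :=
  ∑ z ∈ Finset.univ.image Z, ∑ w ∈ Finset.univ.image W,
    pmass μ₁ Z z * pmass μ₂ W w * rdist (condMeas μ₁ Z z) X (condMeas μ₂ W w) Y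

/-- Conditional Ruzsa distance `d[X ; Y | W]`, conditioning only on the right variable. -/
def condRdistRight {Ω₁ Ω₂ G U : Type*} [Fintype Ω₁] [Fintype Ω₂] [AddCommGroup G]
    (μ₁ : Ω₁ → ℝ) (X : Ω₁ → G)
    (μ₂ : Ω₂ → ℝ) (Y : Ω₂ → G) (W : Ω₂ → U) : ℝ :=
  ∑ w ∈ Finset.univ.image W, pmass μ₂ W w * rdist μ₁ X (condMeas μ₂ W w) Y

/-- The uniform probability mass function on a subset `H` of a finite type. -/
def unifOn {G : Type*} [Fintype G] (H : Set G) : G → ℝ :=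
  fun g => if g ∈ H then ((Nat.card H : ℝ))⁻¹ else 0

/-- `X` (under `μ₁`) and `Y` (under `μ₂`) are identically distributed. -/
def IdentDist {Ω₁ Ω₂ S : Type*} [Fintype Ω₁] [Fintype Ω₂]
    (μ₁ : Ω₁ → ℝ) (X : Ω₁ → S) (μ₂ : Ω₂ → ℝ) (Y : Ω₂ → S) : Prop :=
  ∀ s, pmass μ₁ X s = pmass μ₂ Y s

/-- Two random variables are independent. -/
def IndepPair {Ω S T : Type*} [Fintype Ω] (μ : Ω → ℝ) (X : Ω → S) (Y : Ω → T) : Prop :=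
  ∀ s t, pmass μ (fun ω => (X ω, Y ω)) (s, t) = pmass μ X s * pmass μ Y t

/-- Three random variables are jointly independent. -/
def IndepTriple {Ω S T U : Type*} [Fintype Ω] (μ : Ω → ℝ)
    (X : Ω → S) (Y : Ω → T) (Z : Ω → U) : Prop :=
  ∀ s t u, pmass μ (fun ω => (X ω, Y ω, Z ω)) (s, t, u)
    = pmass μ X s * pmass μ Y t * pmass μ Z u

/-- Four random variables are jointly independent. -/
def IndepFour {Ω S T U V : Type*} [Fintype Ω] (μ : Ω → ℝ)
    (X : Ω → S) (Y : Ω → T) (Z : Ω → U) (W : Ω → V) : Prop :=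
  ∀ s t u v, pmass μ (fun ω => (X ω, Y ω, Z ω, W ω)) (s, t, u, v)
    = pmass μ X s * pmass μ Y t * pmass μ Z u * pmass μ W v


theorem pm_sum {Ω S : Type*} [Fintype Ω] (μ : Ω → ℝ) (X : Ω → S) (T : Finset S)
    (hT : ∀ ω, X ω ∈ T) (f : S → ℝ) :
    ∑ s ∈ T, pmass μ X s * f s = ∑ ω, μ ω * f (X ω) := by
  simp only [pmass, Finset.sum_mul]
  rw [Finset.sum_comm]
  refine Finset.sum_congr rfl fun ω _ => ?_
  simp only [ite_mul, zero_mul]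
  rw [Finset.sum_ite_eq]
  simp [hT ω]

theorem ent_eq {Ω S : Type*} [Fintype Ω] (μ : Ω → ℝ) (X : Ω → S) :
    ent μ X = ∑ ω, μ ω * (- Real.log (pmass μ X (X ω))) := by
  rw [← pm_sum μ X (Finset.univ.image X) (fun ω => by simp) (fun s => - Real.log (pmass μ X s))]
  unfold ent
  refine Finset.sum_congr rfl fun s _ => ?_
  simp [Real.negMulLog]

theorem pmass_congr {Ω S T : Type*} [Fintype Ω] (μ : Ω → ℝ) (X : Ω → S) (Y : Ω → T) (s : S) (t : T)
    (h : ∀ ω, X ω = s ↔ Y ω = t) : pmass μ X s = pmass μ Y t := by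
  unfold pmass
  refine Finset.sum_congr rfl fun ω _ => ?_
  simp [h ω]

theorem ent_congr {Ω S T : Type*} [Fintype Ω] (μ : Ω → ℝ) (X : Ω → S) (Y : Ω → T)
    (h : ∀ ω ω', X ω' = X ω ↔ Y ω' = Y ω) : ent μ X = ent μ Y := by
  rw [ent_eq, ent_eq]
  refine Finset.sum_congr rfl fun ω _ => ?_
  rw [pmass_congr μ X Y (X ω) (Y ω) (h ω)]

theorem pmass_nonneg {Ω S : Type*} [Fintype Ω] (μ : Ω → ℝ) (h : ∀ ω, 0 ≤ μ ω) (X : Ω → S) (s : S) :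
    0 ≤ pmass μ X s := by
  unfold pmass
  refine Finset.sum_nonneg fun ω _ => ?_
  split_ifs <;> simp [h]

theorem le_pmass {Ω S : Type*} [Fintype Ω] (μ : Ω → ℝ) (h : ∀ ω, 0 ≤ μ ω) (X : Ω → S) (ω : Ω) :
    μ ω ≤ pmass μ X (X ω) := by
  unfold pmass
  have := Finset.single_le_sum (f := fun ω' => if X ω' = X ω then μ ω' else 0)
    (fun ω' _ => by split_ifs <;> simp [h]) (Finset.mem_univ ω)
  simpa using this

theorem pmass_cond {Ω S T : Type*} [Fintype Ω] (μ : Ω → ℝ) (X : Ω → S) (Z : Ω → T) (s : S) (z : T) :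
    pmass (condMeas μ Z z) X s = pmass μ (fun ω => (X ω, Z ω)) (s, z) / pmass μ Z z := by
  simp only [pmass, condMeas, Finset.sum_div]
  refine Finset.sum_congr rfl fun ω _ => ?_
  by_cases h1 : X ω = s <;> by_cases h2 : Z ω = z <;> simp [h1, h2, pmass]

theorem cond_ent {Ω S T : Type*} [Fintype Ω] (μ : Ω → ℝ) (h : ∀ ω, 0 ≤ μ ω)
    (X : Ω → S) (Z : Ω → T) (A : Finset T) (hA : ∀ ω, Z ω ∈ A) :
    ∑ z ∈ A, pmass μ Z z * ent (condMeas μ Z z) X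
      = ent μ (fun ω => (X ω, Z ω)) - ent μ Z := by
  have key : ∀ z ∈ A, pmass μ Z z * ent (condMeas μ Z z) X = ∑ ω, if Z ω = z then
      μ ω * (- Real.log (pmass μ (fun ω => (X ω, Z ω)) (X ω, Z ω))) -
        μ ω * (- Real.log (pmass μ Z (Z ω))) else 0 := by
    intro z _
    rw [ent_eq, Finset.mul_sum]
    refine Finset.sum_congr rfl fun ω _ => ?_
    rw [pmass_cond]
    by_cases hz : Z ω = z
    · subst hz
      simp only [condMeas, if_true]
      rcases (h ω).eq_or_lt with h0 | h0
      · simp [← h0]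
      have h1 := h0.trans_le (le_pmass μ h Z ω)
      have h2 := h0.trans_le (le_pmass μ h (fun ω => (X ω, Z ω)) ω)
      rw [Real.log_div h2.ne' h1.ne']
      field_simp
      ring
    · simp [condMeas, hz]
  rw [Finset.sum_congr rfl key, Finset.sum_comm, ent_eq, ent_eq, ← Finset.sum_sub_distrib]
  refine Finset.sum_congr rfl fun ω _ => ?_
  rw [Finset.sum_ite_eq]
  simp [hA ω]

theorem pmass_total {Ω S : Type*} [Fintype Ω] (μ : Ω → ℝ) (X : Ω → S) (T : Finset S)
    (hT : ∀ ω, X ω ∈ T) : ∑ s ∈ T, pmass μ X s = ∑ ω, μ ω := by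
  simpa using pm_sum μ X T hT (fun _ => 1)

theorem mi_nonneg {Ω S T : Type*} [Fintype Ω] (μ : Ω → ℝ) (hμ : IsProb μ)
    (X : Ω → S) (Y : Ω → T) : 0 ≤ mutualInfo μ X Y := by
  obtain ⟨h, h1⟩ := hμ
  unfold mutualInfo
  rw [ent_eq, ent_eq, ent_eq, ← Finset.sum_add_distrib, ← Finset.sum_sub_distrib]
  set P : S × T → ℝ := pmass μ (fun ω => (X ω, Y ω)) with hP
  have step : ∀ ω ∈ (Finset.univ : Finset Ω), μ ω * (1 - pmass μ X (X ω) * pmass μ Y (Y ω) / P (X ω, Y ω)) ≤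
      μ ω * (- Real.log (pmass μ X (X ω))) + μ ω * (- Real.log (pmass μ Y (Y ω)))
       - μ ω * (- Real.log (P (X ω, Y ω))) := by
    intro ω _
    rcases (h ω).eq_or_lt with h0 | h0
    · simp [← h0]
    have a1 := h0.trans_le (le_pmass μ h X ω)
    have a2 := h0.trans_le (le_pmass μ h Y ω)
    have a3 : 0 < P (X ω, Y ω) := h0.trans_le (le_pmass μ h (fun ω => (X ω, Y ω)) ω)
    have := Real.log_le_sub_one_of_pos (div_pos (mul_pos a1 a2) a3)
    rw [Real.log_div (mul_pos a1 a2).ne' a3.ne', Real.log_mul a1.ne' a2.ne'] at this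
    nlinarith
  refine le_trans ?_ (Finset.sum_le_sum step)
  simp only [mul_sub, mul_one, Finset.sum_sub_distrib, h1]
  have e := pm_sum μ (fun ω => (X ω, Y ω)) (Finset.univ.image X ×ˢ Finset.univ.image Y)
    (fun ω => by simp) (fun p => pmass μ X p.1 * pmass μ Y p.2 / P p)
  dsimp only at e
  rw [← e, ← hP]
  have : ∑ p ∈ Finset.univ.image X ×ˢ Finset.univ.image Y, P p * (pmass μ X p.1 * pmass μ Y p.2 / P p)
      ≤ ∑ p ∈ Finset.univ.image X ×ˢ Finset.univ.image Y, pmass μ X p.1 * pmass μ Y p.2 := by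
    refine Finset.sum_le_sum fun p _ => ?_
    by_cases hp : P p = 0
    · simp only [hp, zero_mul]
      exact mul_nonneg (pmass_nonneg μ h X _) (pmass_nonneg μ h Y _)
    · rw [mul_div_cancel₀ _ hp]
  rw [Finset.sum_product] at this
  rw [Finset.sum_product] at this
  simp only [← Finset.mul_sum] at this
  rw [pmass_total μ Y _ (fun ω => by simp), ← Finset.sum_mul, pmass_total μ X _ (fun ω => by simp), h1] at this
  rw [Finset.sum_product]
  linarith

theorem cmi_eq {Ω S T U : Type*} [Fintype Ω] (μ : Ω → ℝ) (h : ∀ ω, 0 ≤ μ ω)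
    (X : Ω → S) (Y : Ω → T) (Z : Ω → U) :
    condMutualInfo μ X Y Z = ent μ (fun ω => (X ω, Z ω)) + ent μ (fun ω => (Y ω, Z ω))
      - ent μ (fun ω => ((X ω, Y ω), Z ω)) - ent μ Z := by
  unfold condMutualInfo mutualInfo
  simp only [mul_sub, mul_add, Finset.sum_sub_distrib, Finset.sum_add_distrib]
  rw [cond_ent μ h _ _ _ (fun ω => by simp), cond_ent μ h _ _ _ (fun ω => by simp),
    cond_ent μ h _ _ _ (fun ω => by simp)]
  ring

theorem cond_isProb {Ω T : Type*} [Fintype Ω] (μ : Ω → ℝ) (h : ∀ ω, 0 ≤ μ ω)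
    (Z : Ω → T) (z : T) (hz : pmass μ Z z ≠ 0) : IsProb (condMeas μ Z z) := by
  refine ⟨fun ω => ?_, ?_⟩
  · unfold condMeas
    split_ifs
    · exact div_nonneg (h ω) (pmass_nonneg μ h Z z)
    · exact le_rfl
  · have : ∑ ω, condMeas μ Z z ω = (∑ ω, if Z ω = z then μ ω else 0) / pmass μ Z z := by
      rw [Finset.sum_div]
      refine Finset.sum_congr rfl fun ω _ => ?_
      unfold condMeas
      split_ifs <;> simp
    rw [this]
    exact div_self hz

theorem cmi_nonneg {Ω S T U : Type*} [Fintype Ω] (μ : Ω → ℝ) (h : ∀ ω, 0 ≤ μ ω)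
    (X : Ω → S) (Y : Ω → T) (Z : Ω → U) : 0 ≤ condMutualInfo μ X Y Z := by
  unfold condMutualInfo
  refine Finset.sum_nonneg fun z _ => ?_
  by_cases hz : pmass μ Z z = 0
  · simp [hz]
  · exact mul_nonneg (pmass_nonneg μ h Z z) (mi_nonneg _ (cond_isProb μ h Z z hz) X Y)

theorem pmass_comp {Ω S T : Type*} [Fintype Ω] (μ : Ω → ℝ) (X : Ω → S) (f : S → T)
    (A : Finset S) (hA : ∀ ω, X ω ∈ A) (t : T) :
    pmass μ (fun ω => f (X ω)) t = ∑ s ∈ A, pmass μ X s * (if f s = t then 1 else 0) := by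
  rw [pm_sum μ X A hA (fun s => if f s = t then 1 else 0)]
  simp [pmass]

theorem ent_superset {Ω S : Type*} [Fintype Ω] (μ : Ω → ℝ) (X : Ω → S)
    (A : Finset S) (hA : ∀ ω, X ω ∈ A) :
    ent μ X = ∑ s ∈ A, Real.negMulLog (pmass μ X s) := by
  rw [ent_eq, ← pm_sum μ X A hA (fun s => - Real.log (pmass μ X s))]
  refine Finset.sum_congr rfl fun s _ => ?_
  simp [Real.negMulLog]

theorem ent_ident {Ω Ω' S T : Type*} [Fintype Ω] [Fintype Ω'] (μ : Ω → ℝ) (ν : Ω' → ℝ)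
    (X : Ω → S) (Y : Ω' → S) (hXY : ∀ s, pmass μ X s = pmass ν Y s) (f : S → T) :
    ent μ (fun ω => f (X ω)) = ent ν (fun ω => f (Y ω)) := by
  have hp : ∀ t, pmass μ (fun ω => f (X ω)) t = pmass ν (fun ω => f (Y ω)) t := by
    intro t
    rw [pmass_comp μ X f (Finset.univ.image X ∪ Finset.univ.image Y) (fun ω => by simp),
      pmass_comp ν Y f (Finset.univ.image X ∪ Finset.univ.image Y) (fun ω => by simp)]
    simp only [hXY]
  rw [ent_superset μ _ (Finset.univ.image (fun ω => f (X ω)) ∪ Finset.univ.image (fun ω => f (Y ω)))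
      (fun ω => Finset.mem_union_left _ (Finset.mem_image_of_mem _ (Finset.mem_univ ω))),
    ent_superset ν _ (Finset.univ.image (fun ω => f (X ω)) ∪ Finset.univ.image (fun ω => f (Y ω)))
      (fun ω => Finset.mem_union_right _ (Finset.mem_image_of_mem _ (Finset.mem_univ ω)))]
  simp only [hp]

theorem pmass_prod {Ω₁ Ω₂ S T : Type*} [Fintype Ω₁] [Fintype Ω₂] (μ₁ : Ω₁ → ℝ) (μ₂ : Ω₂ → ℝ)
    (X : Ω₁ → S) (Y : Ω₂ → T) (s : S) (t : T) :
    pmass (fun p : Ω₁ × Ω₂ => μ₁ p.1 * μ₂ p.2) (fun p => (X p.1, Y p.2)) (s, t)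
      = pmass μ₁ X s * pmass μ₂ Y t := by
  simp only [pmass]
  rw [Finset.sum_mul_sum, Fintype.sum_prod_type]
  refine Finset.sum_congr rfl fun a _ => Finset.sum_congr rfl fun b _ => ?_
  by_cases h1 : X a = s <;> by_cases h2 : Y b = t <;> simp [h1, h2]

theorem condMeas_prod {Ω₁ Ω₂ S T : Type*} [Fintype Ω₁] [Fintype Ω₂] (μ₁ : Ω₁ → ℝ) (μ₂ : Ω₂ → ℝ)
    (X : Ω₁ → S) (Y : Ω₂ → T) (s : S) (t : T) :
    (fun p : Ω₁ × Ω₂ => condMeas μ₁ X s p.1 * condMeas μ₂ Y t p.2) =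
    condMeas (fun p : Ω₁ × Ω₂ => μ₁ p.1 * μ₂ p.2) (fun p => (X p.1, Y p.2)) (s, t) := by
  funext p
  simp only [condMeas, pmass_prod]
  by_cases h1 : X p.1 = s <;> by_cases h2 : Y p.2 = t <;> simp [h1, h2, mul_div_mul_comm]

theorem condRdist_eq {Ω G T : Type*} [Fintype Ω] [AddCommGroup G]
    (μ : Ω → ℝ) (hμ : IsProb μ) (X Y : Ω → G) (Z W : Ω → T) :
    condRdist μ X Z μ Y W =
      ent (fun p : Ω × Ω => μ p.1 * μ p.2) (fun p => (X p.1 - Y p.2, (Z p.1, W p.2)))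
      - ent (fun p : Ω × Ω => μ p.1 * μ p.2) (fun p => (Z p.1, W p.2))
      - (ent μ (fun ω => (X ω, Z ω)) - ent μ Z) / 2
      - (ent μ (fun ω => (Y ω, W ω)) - ent μ W) / 2 := by
  obtain ⟨h, h1⟩ := hμ
  have e1 := cond_ent (fun p : Ω × Ω => μ p.1 * μ p.2) (fun p => mul_nonneg (h _) (h _))
    (fun p => X p.1 - Y p.2) (fun p => (Z p.1, W p.2))
    (Finset.univ.image Z ×ˢ Finset.univ.image W) (fun ω => by simp)
  rw [Finset.sum_product] at e1
  have e2 := cond_ent μ h X Z (Finset.univ.image Z) (fun ω => by simp)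
  have e3 := cond_ent μ h Y W (Finset.univ.image W) (fun ω => by simp)
  have t2 := pmass_total μ Z (Finset.univ.image Z) (fun ω => by simp)
  have t3 := pmass_total μ W (Finset.univ.image W) (fun ω => by simp)
  rw [h1] at t2 t3
  rw [← e1, ← e2, ← e3]
  unfold condRdist rdist
  simp only [condMeas_prod, pmass_prod, mul_sub, Finset.sum_sub_distrib]
  congr 1
  · congr 1
    rw [Finset.sum_div]
    refine Finset.sum_congr rfl fun z _ => ?_
    rw [← Finset.sum_mul, ← Finset.mul_sum, t3]
    ring
  · rw [Finset.sum_comm, Finset.sum_div]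
    refine Finset.sum_congr rfl fun z _ => ?_
    rw [← Finset.sum_mul, ← Finset.sum_mul, t2]
    ring

/-- **The fibring lemma.** For a homomorphism `π : H → H'` and `H`-valued random
variables `Z₁, Z₂`:
`d[Z₁; Z₂] ≥ d[π(Z₁); π(Z₂)] + d[Z₁ | π(Z₁); Z₂ | π(Z₂)]`, and if `Z₁, Z₂` are
independent then the difference of the two sides equals
`I[Z₁ - Z₂ : (π(Z₁), π(Z₂)) | π(Z₁ - Z₂)]`. -/
theorem fibring_lemma {H H' Ω : Type*} [AddCommGroup H] [AddCommGroup H'] [Fintype Ω]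
    (π : H →+ H') (μ : Ω → ℝ) (hμ : IsProb μ) (Z₁ Z₂ : Ω → H) :
    rdist μ Z₁ μ Z₂
      ≥ rdist μ (fun ω => π (Z₁ ω)) μ (fun ω => π (Z₂ ω))
        + condRdist μ Z₁ (fun ω => π (Z₁ ω)) μ Z₂ (fun ω => π (Z₂ ω))
    ∧ (IndepPair μ Z₁ Z₂ →
        rdist μ Z₁ μ Z₂
          - (rdist μ (fun ω => π (Z₁ ω)) μ (fun ω => π (Z₂ ω))
              + condRdist μ Z₁ (fun ω => π (Z₁ ω)) μ Z₂ (fun ω => π (Z₂ ω)))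
        = condMutualInfo μ (fun ω => Z₁ ω - Z₂ ω)
            (fun ω => (π (Z₁ ω), π (Z₂ ω))) (fun ω => π (Z₁ ω - Z₂ ω))) := by
  have hν : ∀ p : Ω × Ω, 0 ≤ μ p.1 * μ p.2 := fun p => mul_nonneg (hμ.1 _) (hμ.1 _)
  have key : rdist μ Z₁ μ Z₂
          - (rdist μ (fun ω => π (Z₁ ω)) μ (fun ω => π (Z₂ ω))
              + condRdist μ Z₁ (fun ω => π (Z₁ ω)) μ Z₂ (fun ω => π (Z₂ ω)))
        = condMutualInfo (fun p : Ω × Ω => μ p.1 * μ p.2) (fun p => Z₁ p.1 - Z₂ p.2)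
            (fun p => (π (Z₁ p.1), π (Z₂ p.2))) (fun p => π (Z₁ p.1 - Z₂ p.2)) := by
    rw [condRdist_eq μ hμ, cmi_eq _ hν]
    unfold rdist
    rw [ent_congr μ (fun ω => (Z₁ ω, π (Z₁ ω))) Z₁ (fun a b => by
        simp only [Prod.mk.injEq]; exact ⟨fun h => h.1, fun h => ⟨h, by rw [h]⟩⟩),
      ent_congr μ (fun ω => (Z₂ ω, π (Z₂ ω))) Z₂ (fun a b => by
        simp only [Prod.mk.injEq]; exact ⟨fun h => h.1, fun h => ⟨h, by rw [h]⟩⟩),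
      ent_congr _ (fun p : Ω × Ω => (Z₁ p.1 - Z₂ p.2, π (Z₁ p.1 - Z₂ p.2)))
        (fun p => Z₁ p.1 - Z₂ p.2) (fun a b => by
        simp only [Prod.mk.injEq]; exact ⟨fun h => h.1, fun h => ⟨h, by rw [h]⟩⟩),
      ent_congr _ (fun p : Ω × Ω => ((π (Z₁ p.1), π (Z₂ p.2)), π (Z₁ p.1 - Z₂ p.2)))
        (fun p => (π (Z₁ p.1), π (Z₂ p.2))) (fun a b => by
        simp only [Prod.mk.injEq, map_sub]
        exact ⟨fun h => h.1, fun h => ⟨h, by rw [h.1, h.2]⟩⟩),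
      ent_congr _ (fun p : Ω × Ω =>
          ((Z₁ p.1 - Z₂ p.2, (π (Z₁ p.1), π (Z₂ p.2))), π (Z₁ p.1 - Z₂ p.2)))
        (fun p => (Z₁ p.1 - Z₂ p.2, (π (Z₁ p.1), π (Z₂ p.2)))) (fun a b => by
        simp only [Prod.mk.injEq]; exact ⟨fun h => h.1, fun h => ⟨h, by rw [h.1]⟩⟩)]
    simp only [map_sub]
    ring
  refine ⟨?_, fun hI => ?_⟩
  · have := cmi_nonneg (fun p : Ω × Ω => μ p.1 * μ p.2) hν (fun p => Z₁ p.1 - Z₂ p.2)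
            (fun p => (π (Z₁ p.1), π (Z₂ p.2))) (fun p => π (Z₁ p.1 - Z₂ p.2))
    rw [← key] at this
    linarith
  · rw [key, cmi_eq _ hν, cmi_eq _ hμ.1]
    have hid : ∀ s : H × H, pmass (fun p : Ω × Ω => μ p.1 * μ p.2) (fun p => (Z₁ p.1, Z₂ p.2)) s
        = pmass μ (fun ω => (Z₁ ω, Z₂ ω)) s := by
      rintro ⟨s, t⟩
      rw [pmass_prod, hI]
    have e1 := ent_ident _ _ _ _ hid (fun q => (q.1 - q.2, π (q.1 - q.2)))
    have e2 := ent_ident _ _ _ _ hid (fun q => ((π q.1, π q.2), π (q.1 - q.2)))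
    have e3 := ent_ident _ _ _ _ hid (fun q => ((q.1 - q.2, (π q.1, π q.2)), π (q.1 - q.2)))
    have e4 := ent_ident _ _ _ _ hid (fun q => π (q.1 - q.2))
    dsimp only at e1 e2 e3 e4
    rw [e1, e2, e3, e4]

end
end

section
/- Suppose that (X, Z) and (Y, W) are finitely supported random variables, where X and Y take values in an abelian group G. Then d[X | Z; Y | W] ≤ d[X; Y] + (1/2)·I[X : Z] + (1/2)·I[Y : W]. -/
open scoped Classical BigOperators Pointwise
open Finset

noncomputable section

lemma pmass_eq_zero_aux {Ω S : Type*} [Fintype Ω] (μ : Ω → ℝ) (X : Ω → S) (s : S)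
    (h : ∀ ω, X ω ≠ s) : pmass μ X s = 0 := by
  unfold pmass
  apply Finset.sum_eq_zero
  intro ω _
  rw [if_neg (h ω)]

lemma mem_image_aux {Ω S : Type*} [Fintype Ω] (X : Ω → S) (s : S) :
    s ∈ Finset.univ.image X ↔ ∃ ω, X ω = s := by
  simp

lemma pmass_nonneg_aux {Ω S : Type*} [Fintype Ω] (μ : Ω → ℝ) (hμ : ∀ ω, 0 ≤ μ ω)
    (X : Ω → S) (s : S) : 0 ≤ pmass μ X s := by
  unfold pmass
  apply Finset.sum_nonneg
  intro ω _
  split_ifs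
  · exact hμ ω
  · exact le_rfl

lemma sum_pmass_aux {Ω S : Type*} [Fintype Ω] (μ : Ω → ℝ) (X : Ω → S) :
    ∑ s ∈ Finset.univ.image X, pmass μ X s = ∑ ω, μ ω := by
  unfold pmass
  rw [Finset.sum_comm]
  apply Finset.sum_congr rfl
  intro ω _
  rw [Finset.sum_ite_eq, if_pos (Finset.mem_image_of_mem X (Finset.mem_univ ω))]

lemma mul_condMeas_aux {Ω T : Type*} [Fintype Ω] (μ : Ω → ℝ) (hμ : ∀ ω, 0 ≤ μ ω)
    (Z : Ω → T) (z : T) (ω : Ω) :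
    pmass μ Z z * condMeas μ Z z ω = if Z ω = z then μ ω else 0 := by
  unfold condMeas
  split_ifs with h
  · by_cases hp : pmass μ Z z = 0
    · have h0 := hp
      unfold pmass at h0
      rw [Finset.sum_eq_zero_iff_of_nonneg
        (fun i _ => by split_ifs; exacts [hμ i, le_rfl])] at h0
      have := h0 ω (Finset.mem_univ ω)
      rw [if_pos h] at this
      rw [this, hp]; simp
    · field_simp
  · simp

lemma condMeas_nonneg_aux {Ω T : Type*} [Fintype Ω] (μ : Ω → ℝ) (hμ : ∀ ω, 0 ≤ μ ω)
    (Z : Ω → T) (z : T) (ω : Ω) : 0 ≤ condMeas μ Z z ω := by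
  unfold condMeas
  split_ifs
  · exact div_nonneg (hμ ω) (pmass_nonneg_aux μ hμ Z z)
  · exact le_rfl

lemma mul_sum_condMeas_aux {Ω T : Type*} [Fintype Ω] (μ : Ω → ℝ) (hμ : ∀ ω, 0 ≤ μ ω)
    (Z : Ω → T) (z : T) :
    pmass μ Z z * ∑ ω, condMeas μ Z z ω = pmass μ Z z := by
  rw [Finset.mul_sum]
  simp_rw [mul_condMeas_aux μ hμ]
  rfl

lemma chain_aux {Ω S T : Type*} [Fintype Ω] (μ : Ω → ℝ) (hμ : ∀ ω, 0 ≤ μ ω)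
    (X : Ω → S) (Z : Ω → T) :
    ∑ z ∈ Finset.univ.image Z, pmass μ Z z * ent (condMeas μ Z z) X
      = ent μ (fun ω => (X ω, Z ω)) - ent μ Z := by
  have h1 : ent μ (fun ω => (X ω, Z ω)) = ∑ q ∈ (Finset.univ.image X) ×ˢ (Finset.univ.image Z),
      Real.negMulLog (pmass μ (fun ω => (X ω, Z ω)) q) := by
    unfold ent
    apply Finset.sum_subset
    · intro q hq
      obtain ⟨ω, rfl⟩ := (mem_image_aux _ _).1 hq
      simp
    · intro q _ hq
      rw [pmass_eq_zero_aux _ _ _ ?_, Real.negMulLog_zero]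
      intro ω hω
      exact hq ((mem_image_aux _ _).2 ⟨ω, hω⟩)
  have h2 : ∀ x z, pmass μ (fun ω => (X ω, Z ω)) (x, z)
      = pmass μ Z z * pmass (condMeas μ Z z) X x := by
    intro x z
    conv_rhs => rw [pmass.eq_def (condMeas μ Z z)]
    rw [Finset.mul_sum, pmass.eq_def]
    apply Finset.sum_congr rfl
    intro ω _
    rw [mul_ite, mul_condMeas_aux μ hμ, mul_zero]
    simp only [Prod.mk.injEq]
    split_ifs <;> simp_all
  rw [h1, Finset.sum_product_right, eq_sub_iff_add_eq, ent.eq_def μ Z, ← Finset.sum_add_distrib]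
  apply Finset.sum_congr rfl
  intro z _
  simp_rw [h2, Real.negMulLog_mul]
  rw [Finset.sum_add_distrib, ← Finset.sum_mul, ← Finset.mul_sum, sum_pmass_aux, add_comm]
  congr 1
  have := mul_sum_condMeas_aux μ hμ Z z
  by_cases hp : pmass μ Z z = 0
  · rw [hp]; simp
  · rw [mul_right_eq_self₀.1 this |>.resolve_right hp, one_mul]

lemma mix_aux {Ω T : Type*} [Fintype Ω] (μ : Ω → ℝ) (hμ : ∀ ω, 0 ≤ μ ω)
    (Z : Ω → T) (ω : Ω) :
    ∑ z ∈ Finset.univ.image Z, pmass μ Z z * condMeas μ Z z ω = μ ω := by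
  simp_rw [mul_condMeas_aux μ hμ]
  rw [Finset.sum_ite_eq, if_pos (Finset.mem_image_of_mem Z (Finset.mem_univ ω))]

lemma ent_mix_aux {Ω S I : Type*} [Fintype Ω] (s : Finset I) (p : I → ℝ) (ν : I → Ω → ℝ)
    (μ : Ω → ℝ) (D : Ω → S) (hp : ∀ i ∈ s, 0 ≤ p i) (h1 : ∑ i ∈ s, p i = 1)
    (hν : ∀ i ω, 0 ≤ ν i ω) (hμ : ∀ ω, ∑ i ∈ s, p i * ν i ω = μ ω) :
    ∑ i ∈ s, p i * ent (ν i) D ≤ ent μ D := by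
  unfold ent
  simp_rw [Finset.mul_sum]
  rw [Finset.sum_comm]
  apply Finset.sum_le_sum
  intro x _
  have hx : pmass μ D x = ∑ i ∈ s, p i * pmass (ν i) D x := by
    unfold pmass
    simp_rw [Finset.mul_sum]
    rw [Finset.sum_comm]
    apply Finset.sum_congr rfl
    intro ω _
    split_ifs
    · exact (hμ ω).symm
    · simp
  rw [hx]
  have := Real.concaveOn_negMulLog.le_map_sum (t := s) (w := p)
    (p := fun i => pmass (ν i) D x) hp h1 (fun i _ => pmass_nonneg_aux _ (hν i) D x)
  simpa only [smul_eq_mul] using this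

/-- **Lemma 5.1: conditioning changes Ruzsa distance by at most half the mutual
informations.** `d[X | Z; Y | W] ≤ d[X; Y] + I[X : Z]/2 + I[Y : W]/2`. -/
theorem cond_rdist_le {G T U Ω₁ Ω₂ : Type*} [AddCommGroup G] [Fintype Ω₁] [Fintype Ω₂]
    (μ₁ : Ω₁ → ℝ) (μ₂ : Ω₂ → ℝ) (hμ₁ : IsProb μ₁) (hμ₂ : IsProb μ₂)
    (X : Ω₁ → G) (Z : Ω₁ → T) (Y : Ω₂ → G) (W : Ω₂ → U) :
    condRdist μ₁ X Z μ₂ Y W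
      ≤ rdist μ₁ X μ₂ Y + mutualInfo μ₁ X Z / 2 + mutualInfo μ₂ Y W / 2 := by
  have e1 := sum_pmass_aux μ₁ Z
  have e2 := sum_pmass_aux μ₂ W
  rw [hμ₁.2] at e1
  rw [hμ₂.2] at e2
  have c1 := chain_aux μ₁ hμ₁.1 X Z
  have c2 := chain_aux μ₂ hμ₂.1 Y W
  have key := ent_mix_aux ((Finset.univ.image Z) ×ˢ (Finset.univ.image W))
    (fun q => pmass μ₁ Z q.1 * pmass μ₂ W q.2)
    (fun q (p : Ω₁ × Ω₂) => condMeas μ₁ Z q.1 p.1 * condMeas μ₂ W q.2 p.2)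
    (fun p : Ω₁ × Ω₂ => μ₁ p.1 * μ₂ p.2) (fun p => X p.1 - Y p.2)
    (fun q _ => mul_nonneg (pmass_nonneg_aux _ hμ₁.1 _ _) (pmass_nonneg_aux _ hμ₂.1 _ _))
    (by rw [Finset.sum_product, ← Finset.sum_mul_sum, e1, e2, one_mul])
    (fun q p => mul_nonneg (condMeas_nonneg_aux _ hμ₁.1 _ _ _)
      (condMeas_nonneg_aux _ hμ₂.1 _ _ _))
    (by
      intro p
      simp_rw [mul_mul_mul_comm]
      rw [Finset.sum_product]
      dsimp only
      rw [← Finset.sum_mul_sum, mix_aux μ₁ hμ₁.1, mix_aux μ₂ hμ₂.1])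
  rw [Finset.sum_product] at key
  have d : condRdist μ₁ X Z μ₂ Y W
      = (∑ z ∈ Finset.univ.image Z, ∑ w ∈ Finset.univ.image W,
          pmass μ₁ Z z * pmass μ₂ W w *
            ent (fun p : Ω₁ × Ω₂ => condMeas μ₁ Z z p.1 * condMeas μ₂ W w p.2)
              (fun p => X p.1 - Y p.2))
        - (∑ z ∈ Finset.univ.image Z, pmass μ₁ Z z * ent (condMeas μ₁ Z z) X)
          * (∑ w ∈ Finset.univ.image W, pmass μ₂ W w) / 2
        - (∑ z ∈ Finset.univ.image Z, pmass μ₁ Z z)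
          * (∑ w ∈ Finset.univ.image W, pmass μ₂ W w * ent (condMeas μ₂ W w) Y) / 2 := by
    unfold condRdist rdist
    rw [Finset.sum_mul_sum, Finset.sum_mul_sum]
    simp_rw [Finset.sum_div, ← Finset.sum_sub_distrib]
    refine Finset.sum_congr rfl fun z _ => Finset.sum_congr rfl fun w _ => ?_
    ring
  rw [d, e1, e2, c1, c2]
  unfold rdist mutualInfo
  linarith

end
end
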